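/- arXiv:1105.5490 — 2 statements merged into one kernel-verified Lean document; each statement's English description precedes it below -/
import Mathlib

section
/- For every integer k ≥ 3 there exist infinitely many pairwise non-isomorphic connected k-regular finite simple graphs G whose smallest adjacency eigenvalue λmin(G) lies in the half-open interval [−1−√2, −2). -/
open SimpleGraph Filter

attribute [local instance] Classical.propDecidable

lemma adjMatrix_isHermitian {V : Type} [Fintype V] [DecidableEq V] (G : SimpleGraph V)
    [DecidableRel G.Adj] : (G.adjMatrix ℝ).IsHermitian := by
  rw [Matrix.IsHermitian, Matrix.conjTranspose_eq_transpose_of_trivial]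
  exact G.isSymm_adjMatrix

/-- The smallest eigenvalue of the (real) adjacency matrix of a finite simple graph. -/
noncomputable def lambdaMin {V : Type} [Fintype V] (G : SimpleGraph V) : ℝ :=
  ⨅ i : V, (adjMatrix_isHermitian G).eigenvalues i

/-- Vertices of a ring of `n + 1` blocks. Block `j` consists of two cliques of size `m + 1`, namely
`{c j i} ∪ {p j}` and `{d j i} ∪ {q j}`, and one clique `{x j i}` of size `m`. -/
abbrev RingVertex (n m : ℕ) : Type :=
  (Fin (n + 1) × Fin m) ⊕ (Fin (n + 1) × Fin m) ⊕ (Fin (n + 1) × Fin m) ⊕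
    Fin (n + 1) ⊕ Fin (n + 1)

namespace RingVertex

variable {n m : ℕ}

/-- A vertex of the first large clique of block `j`. -/
abbrev c (j : Fin (n + 1)) (i : Fin m) : RingVertex n m := .inl (j, i)

/-- A vertex of the small clique of block `j`. -/
abbrev x (j : Fin (n + 1)) (i : Fin m) : RingVertex n m := .inr (.inl (j, i))

/-- A vertex of the second large clique of block `j`. -/
abbrev d (j : Fin (n + 1)) (i : Fin m) : RingVertex n m := .inr (.inr (.inl (j, i)))

/-- The vertex of the first large clique of block `j` that is joined to the previous block. -/
abbrev p (j : Fin (n + 1)) : RingVertex n m := .inr (.inr (.inr (.inl j)))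

/-- The vertex of the second large clique of block `j` that is joined to the next block. -/
abbrev q (j : Fin (n + 1)) : RingVertex n m := .inr (.inr (.inr (.inr j)))

/-- Adjacency in the ring of blocks: besides the cliques, there are the paths
`c j i - x j i - d j i` and the edges `q j - p (j + 1)`. -/
def Adjacent : RingVertex n m → RingVertex n m → Prop
  | .inl a, .inl b => a.1 = b.1 ∧ a.2 ≠ b.2
  | .inl a, .inr (.inl b) => a.1 = b.1 ∧ a.2 = b.2
  | .inr (.inl a), .inl b => a.1 = b.1 ∧ a.2 = b.2
  | .inr (.inl a), .inr (.inl b) => a.1 = b.1 ∧ a.2 ≠ b.2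
  | .inr (.inl a), .inr (.inr (.inl b)) => a.1 = b.1 ∧ a.2 = b.2
  | .inr (.inr (.inl a)), .inr (.inl b) => a.1 = b.1 ∧ a.2 = b.2
  | .inr (.inr (.inl a)), .inr (.inr (.inl b)) => a.1 = b.1 ∧ a.2 ≠ b.2
  | .inl a, .inr (.inr (.inr (.inl j))) => a.1 = j
  | .inr (.inr (.inr (.inl j))), .inl a => a.1 = j
  | .inr (.inr (.inl a)), .inr (.inr (.inr (.inr j))) => a.1 = j
  | .inr (.inr (.inr (.inr j))), .inr (.inr (.inl a)) => a.1 = j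
  | .inr (.inr (.inr (.inl j))), .inr (.inr (.inr (.inr l))) => l = j - 1
  | .inr (.inr (.inr (.inr j))), .inr (.inr (.inr (.inl l))) => l = j + 1
  | _, _ => False

end RingVertex

open RingVertex

/-- The ring of `n + 1` blocks as a simple graph. -/
def ringGraph (n m : ℕ) : SimpleGraph (RingVertex n m) where
  Adj := Adjacent
  symm := ⟨by
    rintro (a | a | a | a | a) (b | b | b | b | b) <;> simp only [Adjacent] <;> grind⟩
  loopless := ⟨by rintro (a | a | a | a | a) <;> simp [Adjacent]⟩

lemma ringGraph_adj {n m : ℕ} {u v : RingVertex n m} :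
    (ringGraph n m).Adj u v ↔ Adjacent u v := Iff.rfl

section NeighborSums

variable {n m : ℕ} (f : RingVertex n m → ℝ) (j : Fin (n + 1)) (i : Fin m)

lemma sum_ite_block_ne (g : Fin (n + 1) × Fin m → ℝ)
    {_ : ∀ b : Fin (n + 1) × Fin m, Decidable (j = b.1 ∧ i ≠ b.2)} :
    ∑ b, (if j = b.1 ∧ i ≠ b.2 then g b else 0) = ∑ l, g (j, l) - g (j, i) := by
  rw [Fintype.sum_prod_type, Finset.sum_eq_single j (by intro b _ h; simp [h.symm]) (by simp)]
  rw [← Finset.sum_erase_eq_sub (Finset.mem_univ i), ← Finset.sum_filter]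
  congr 1
  ext l
  simp [eq_comm]

lemma sum_ite_block_eq (g : Fin (n + 1) × Fin m → ℝ)
    {_ : ∀ b : Fin (n + 1) × Fin m, Decidable (j = b.1 ∧ i = b.2)} :
    ∑ b, (if j = b.1 ∧ i = b.2 then g b else 0) = g (j, i) := by
  rw [Finset.sum_eq_single (j, i) (by rintro b _ h; rw [if_neg]; grind) (by simp)]
  simp

lemma sum_ite_block (g : Fin (n + 1) × Fin m → ℝ)
    {_ : ∀ b : Fin (n + 1) × Fin m, Decidable (b.1 = j)} :
    ∑ b, (if b.1 = j then g b else 0) = ∑ l, g (j, l) := by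
  rw [Fintype.sum_prod_type, Finset.sum_eq_single j (by intro b _ h; simp [h]) (by simp)]
  simp

lemma sum_ite_link (g : Fin (n + 1) → ℝ) {_ : ∀ l, Decidable (l = j)} :
    ∑ l, (if l = j then g l else 0) = g j := by
  rw [Finset.sum_eq_single j (by intro b _ h; simp [h]) (by simp)]
  simp

lemma sum_ite_link_symm (g : Fin (n + 1) → ℝ) {_ : ∀ l, Decidable (j = l)} :
    ∑ l, (if j = l then g l else 0) = g j := by
  rw [Finset.sum_eq_single j (by intro b _ h; simp [h.symm]) (by simp)]
  simp

lemma ringGraph_mulVec_c : ((ringGraph n m).adjMatrix ℝ).mulVec f (c j i) =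
    (∑ l, f (c j l) - f (c j i)) + f (x j i) + f (p j) := by
  simp [Matrix.mulVec, dotProduct, adjMatrix_apply, ringGraph_adj, Adjacent, -ne_eq, -ite_not,
    add_assoc]
  exact congrArg₂ _ (sum_ite_block_ne j i _)
    (congrArg₂ _ (sum_ite_block_eq j i _) (sum_ite_link_symm j _))

lemma ringGraph_mulVec_x : ((ringGraph n m).adjMatrix ℝ).mulVec f (x j i) =
    f (c j i) + (∑ l, f (x j l) - f (x j i)) + f (d j i) := by
  simp [Matrix.mulVec, dotProduct, adjMatrix_apply, ringGraph_adj, Adjacent, -ne_eq, -ite_not,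
    add_assoc]
  exact congrArg₂ _ (sum_ite_block_eq j i _)
    (congrArg₂ _ (sum_ite_block_ne j i _) (sum_ite_block_eq j i _))

lemma ringGraph_mulVec_d : ((ringGraph n m).adjMatrix ℝ).mulVec f (d j i) =
    f (x j i) + (∑ l, f (d j l) - f (d j i)) + f (q j) := by
  simp [Matrix.mulVec, dotProduct, adjMatrix_apply, ringGraph_adj, Adjacent, -ne_eq, -ite_not,
    add_assoc]
  exact congrArg₂ _ (sum_ite_block_eq j i _)
    (congrArg₂ _ (sum_ite_block_ne j i _) (sum_ite_link_symm j _))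

lemma ringGraph_mulVec_p : ((ringGraph n m).adjMatrix ℝ).mulVec f (p j) =
    ∑ l, f (c j l) + f (q (j - 1)) := by
  simp [Matrix.mulVec, dotProduct, adjMatrix_apply, ringGraph_adj, Adjacent]
  exact congrArg₂ _ (sum_ite_block j _) (sum_ite_link _ _)

lemma ringGraph_mulVec_q : ((ringGraph n m).adjMatrix ℝ).mulVec f (q j) =
    ∑ l, f (d j l) + f (p (j + 1)) := by
  simp [Matrix.mulVec, dotProduct, adjMatrix_apply, ringGraph_adj, Adjacent]
  exact congrArg₂ _ (sum_ite_block j _) (sum_ite_link _ _)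

end NeighborSums

lemma ringGraph_isRegularOfDegree (n m : ℕ) : (ringGraph n m).IsRegularOfDegree (m + 1) := by
  intro v
  have h := adjMatrix_mulVec_const_apply (G := ringGraph n m) (a := (1 : ℝ)) (v := v)
  rw [mul_one] at h
  rw [← Nat.cast_inj (R := ℝ), ← h]
  obtain ⟨j, i⟩ | ⟨j, i⟩ | ⟨j, i⟩ | j | j := v
  · rw [ringGraph_mulVec_c]; simp
  · rw [ringGraph_mulVec_x]; simp
  · rw [ringGraph_mulVec_d]; simp
  · rw [ringGraph_mulVec_p]; simp
  · rw [ringGraph_mulVec_q]; simp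

lemma ringGraph_connected (n : ℕ) {m : ℕ} (hm : 0 < m) : (ringGraph n m).Connected := by
  have hcx (j : Fin (n + 1)) (i : Fin m) : (ringGraph n m).Reachable (c j i) (x j i) :=
    Adj.reachable (by simp [ringGraph, Adjacent])
  have hxd (j : Fin (n + 1)) (i : Fin m) : (ringGraph n m).Reachable (x j i) (d j i) :=
    Adj.reachable (by simp [ringGraph, Adjacent])
  have hpc (j : Fin (n + 1)) (i : Fin m) : (ringGraph n m).Reachable (p j) (c j i) :=
    Adj.reachable (by simp [ringGraph, Adjacent])
  have hdq (j : Fin (n + 1)) (i : Fin m) : (ringGraph n m).Reachable (d j i) (q j) :=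
    Adj.reachable (by simp [ringGraph, Adjacent])
  have hqp (j : Fin (n + 1)) : (ringGraph n m).Reachable (q j) (p (j + 1)) :=
    Adj.reachable (by simp [ringGraph, Adjacent])
  have hpq (j : Fin (n + 1)) : (ringGraph n m).Reachable (p j) (q j) :=
    (((hpc j ⟨0, hm⟩).trans (hcx j _)).trans (hxd j _)).trans (hdq j _)
  have hp (j : Fin (n + 1)) : (ringGraph n m).Reachable (p 0) (p j) := by
    induction j using Fin.induction with
    | zero => exact .refl _
    | succ l ih =>
      have h := (ih.trans (hpq _)).trans (hqp _)
      rwa [Fin.coeSucc_eq_succ] at h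
  rw [connected_iff_exists_forall_reachable]
  refine ⟨p 0, ?_⟩
  rintro (⟨j, i⟩ | ⟨j, i⟩ | ⟨j, i⟩ | j | j)
  · exact (hp j).trans (hpc j i)
  · exact ((hp j).trans (hpc j i)).trans (hcx j i)
  · exact (((hp j).trans (hpc j i)).trans (hcx j i)).trans (hxd j i)
  · exact hp j
  · exact (hp j).trans (hpq j)

lemma ringGraph_quadraticForm_nonneg {n m : ℕ} (f : RingVertex n m → ℝ) :
    0 ≤ f ⬝ᵥ ((ringGraph n m).adjMatrix ℝ).mulVec f + (1 + Real.sqrt 2) * (f ⬝ᵥ f) := by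
  set s := Real.sqrt 2
  have hs : s ^ 2 = 2 := Real.sq_sqrt (by norm_num)
  have hs1 : 1 ≤ s := Real.one_le_sqrt.2 (by norm_num)
  have key : f ⬝ᵥ ((ringGraph n m).adjMatrix ℝ).mulVec f + (1 + s) * (f ⬝ᵥ f) =
      ∑ j, ((∑ i, f (c j i) + f (p j)) ^ 2 + (∑ i, f (x j i)) ^ 2 +
        (∑ i, f (d j i) + f (q j)) ^ 2) +
      ∑ j, ∑ i, s / 2 * ((f (x j i) + s * f (c j i)) ^ 2 + (f (x j i) + s * f (d j i)) ^ 2) +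
      ((s - 1) * (∑ j, f (p j) ^ 2 + ∑ j, f (q j) ^ 2) +
        2⁻¹ * (∑ j, (f (p j) + f (q (j - 1))) ^ 2 + ∑ j, (f (q j) + f (p (j + 1))) ^ 2)) := by
    have e1 : ∑ j, f (q (j - 1)) ^ 2 = ∑ j, f (q j) ^ 2 :=
      Equiv.sum_comp (Equiv.subRight (1 : Fin (n + 1))) fun j => f (q j) ^ 2
    have e2 : ∑ j, f (p (j + 1)) ^ 2 = ∑ j, f (p j) ^ 2 :=
      Equiv.sum_comp (Equiv.addRight (1 : Fin (n + 1))) fun j => f (p j) ^ 2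
    have e3 (j : Fin (n + 1)) (i : Fin m) :
        s / 2 * ((f (x j i) + s * f (c j i)) ^ 2 + (f (x j i) + s * f (d j i)) ^ 2) =
        s * f (x j i) ^ 2 + s * f (c j i) ^ 2 + s * f (d j i) ^ 2 +
          2 * (f (x j i) * f (c j i)) + 2 * (f (x j i) * f (d j i)) := by
      linear_combination (f (x j i) * f (c j i) + f (x j i) * f (d j i) +
        s / 2 * (f (c j i) ^ 2 + f (d j i) ^ 2)) * hs
    simp only [e3]
    have e4 (a b : Fin m → ℝ) (t : ℝ) : ∑ i, a i * ((∑ l, a l - a i) + b i + t) =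
        (∑ i, a i) ^ 2 - ∑ i, a i ^ 2 + ∑ i, a i * b i + t * ∑ i, a i := by
      simp only [mul_add, mul_sub, Finset.sum_add_distrib, Finset.sum_sub_distrib,
        ← Finset.sum_mul, pow_two]
      ring
    have e5 (a b u : Fin m → ℝ) : ∑ i, a i * (b i + (∑ l, a l - a i) + u i) =
        (∑ i, a i) ^ 2 - ∑ i, a i ^ 2 + ∑ i, a i * b i + ∑ i, a i * u i := by
      simp only [mul_add, mul_sub, Finset.sum_add_distrib, Finset.sum_sub_distrib,
        ← Finset.sum_mul, pow_two]
      ring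
    have e6 (a b : Fin m → ℝ) (t : ℝ) : ∑ i, a i * (b i + (∑ l, a l - a i) + t) =
        (∑ i, a i) ^ 2 - ∑ i, a i ^ 2 + ∑ i, b i * a i + t * ∑ i, a i := by
      simp only [mul_add, mul_sub, Finset.sum_add_distrib, Finset.sum_sub_distrib,
        ← Finset.sum_mul, pow_two, mul_comm (b _)]
      ring
    have e7 (j : Fin (n + 1)) : ∑ i, f (c j i) * f (x j i) = ∑ i, f (x j i) * f (c j i) := by
      simp only [mul_comm]
    simp only [dotProduct, Fintype.sum_sum_type, Fintype.sum_prod_type, ringGraph_mulVec_c,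
      ringGraph_mulVec_x, ringGraph_mulVec_d, ringGraph_mulVec_p, ringGraph_mulVec_q, e4, e6, e7,
      ← pow_two]
    simp only [e5]
    simp only [add_sq, mul_add, Finset.sum_add_distrib, Finset.sum_sub_distrib, e1, e2,
      ← Finset.mul_sum, mul_assoc, mul_comm (f (p _)) (∑ _, _), mul_comm (f (q _)) (∑ _, _)]
    ring
  rw [key]
  have : 0 ≤ s - 1 := by linarith
  positivity

/-- An eigenvector of the ring of blocks for the eigenvalue `-1 - √2`, built from a weight on the
paths `c j i - x j i - d j i`. -/
noncomputable def pathVector (n : ℕ) {m : ℕ} (w : Fin m → ℝ) : RingVertex n m → ℝ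
  | .inl a => w a.2
  | .inr (.inl a) => -Real.sqrt 2 * w a.2
  | .inr (.inr (.inl a)) => w a.2
  | .inr (.inr (.inr _)) => 0

lemma ringGraph_mulVec_pathVector (n : ℕ) {m : ℕ} {w : Fin m → ℝ} (hw : ∑ i, w i = 0) :
    ((ringGraph n m).adjMatrix ℝ).mulVec (pathVector n w) =
      (-1 - Real.sqrt 2) • pathVector n w := by
  have hs : Real.sqrt 2 ^ 2 = 2 := Real.sq_sqrt (by norm_num)
  funext v
  obtain ⟨j, i⟩ | ⟨j, i⟩ | ⟨j, i⟩ | j | j := v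
  · rw [ringGraph_mulVec_c]; simp only [pathVector, hw, Pi.smul_apply, smul_eq_mul]; ring
  · rw [ringGraph_mulVec_x]
    simp only [pathVector, hw, Pi.smul_apply, smul_eq_mul, ← Finset.mul_sum]
    linear_combination -w i * hs
  · rw [ringGraph_mulVec_d]; simp only [pathVector, hw, Pi.smul_apply, smul_eq_mul]; ring
  · rw [ringGraph_mulVec_p]; simp [pathVector, hw]
  · rw [ringGraph_mulVec_q]; simp [pathVector, hw]

lemma lambdaMin_eq_sInf_spectrum {V : Type} [Fintype V] (G : SimpleGraph V) :
    lambdaMin G = sInf (spectrum ℝ (G.adjMatrix ℝ)) := by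
  rw [(adjMatrix_isHermitian G).spectrum_real_eq_range_eigenvalues]
  rfl

lemma lambdaMin_congr {V W : Type} [Fintype V] [Fintype W] {G : SimpleGraph V}
    {H : SimpleGraph W} (e : G ≃g H) : lambdaMin G = lambdaMin H := by
  rw [lambdaMin_eq_sInf_spectrum, lambdaMin_eq_sInf_spectrum]
  have h : H.adjMatrix ℝ = Matrix.reindexAlgEquiv ℝ ℝ e.toEquiv (G.adjMatrix ℝ) := by
    ext a b
    simp only [Matrix.coe_reindexAlgEquiv, Matrix.reindex_apply, Matrix.submatrix_apply,
      adjMatrix_apply]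
    exact if_congr e.symm.map_adj_iff.symm rfl rfl
  rw [h, AlgEquiv.spectrum_eq]

lemma lambdaMin_eq_of_quadraticForm {V : Type} [Fintype V] {G : SimpleGraph V} {μ : ℝ}
    (hG : ∀ f : V → ℝ, μ * (f ⬝ᵥ f) ≤ f ⬝ᵥ (G.adjMatrix ℝ).mulVec f) {g : V → ℝ} (hg : g ≠ 0)
    (hgμ : (G.adjMatrix ℝ).mulVec g = μ • g) : lambdaMin G = μ := by
  rw [lambdaMin_eq_sInf_spectrum]
  refine IsLeast.csInf_eq ⟨?_, ?_⟩
  · rw [← Matrix.spectrum_toLin', ← Module.End.hasEigenvalue_iff_mem_spectrum]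
    exact Module.End.hasEigenvalue_of_hasEigenvector
      ⟨Module.End.mem_eigenspace_iff.2 (by simpa using hgμ), hg⟩
  · intro ν hν
    rw [← Matrix.spectrum_toLin', ← Module.End.hasEigenvalue_iff_mem_spectrum] at hν
    obtain ⟨f, hf, hf0⟩ := hν.exists_hasEigenvector
    rw [Module.End.mem_eigenspace_iff, Matrix.toLin'_apply] at hf
    have h := hG f
    rw [hf, dotProduct_smul, smul_eq_mul] at h
    have hpos : 0 < f ⬝ᵥ f := by
      refine lt_of_le_of_ne (Finset.sum_nonneg fun i _ => mul_self_nonneg _) fun h0 => hf0 ?_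
      exact dotProduct_self_eq_zero.1 h0.symm
    exact le_of_mul_le_mul_right h hpos

lemma lambdaMin_ringGraph (n : ℕ) {m : ℕ} (hm : 2 ≤ m) :
    lambdaMin (ringGraph n m) = -1 - Real.sqrt 2 := by
  let a : Fin m := ⟨0, by omega⟩
  let b : Fin m := ⟨1, by omega⟩
  have hab : a ≠ b := by simp [a, b]
  refine lambdaMin_eq_of_quadraticForm (g := pathVector n (Pi.single a 1 - Pi.single b 1))
    (fun f => ?_) (fun h => ?_)
    (ringGraph_mulVec_pathVector n (by simp))
  · linarith [ringGraph_quadraticForm_nonneg f]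
  · have := congrFun h (c 0 a)
    simp [pathVector, hab] at this

/-- For every integer `k ≥ 3` there exist infinitely many pairwise non-isomorphic connected
`k`-regular finite simple graphs whose smallest adjacency eigenvalue lies in `[-1-√2, -2)`. -/
theorem stmt_0 (k : ℕ) (hk : 3 ≤ k) :
    ∃ f : ℕ → Σ n : ℕ, SimpleGraph (Fin n),
      (∀ i j : ℕ, i ≠ j → ¬ Nonempty ((f i).2 ≃g (f j).2)) ∧
      (∀ i : ℕ, ((f i).2.Connected ∧ (f i).2.IsRegularOfDegree k ∧
        -1 - Real.sqrt 2 ≤ lambdaMin (f i).2 ∧ lambdaMin (f i).2 < -2)) := by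
  obtain ⟨m, rfl⟩ : ∃ m, k = m + 1 := ⟨k - 1, by omega⟩
  refine ⟨fun n => ⟨Fintype.card (RingVertex n m), (ringGraph n m).overFin rfl⟩, ?_, fun n => ?_⟩
  · rintro n l hnl ⟨e⟩
    have h := Fintype.card_congr e.toEquiv
    simp only [Fintype.card_fin, Fintype.card_sum, Fintype.card_prod] at h
    apply hnl
    have : (n + 1) * (3 * m + 2) = (l + 1) * (3 * m + 2) := by linarith
    exact Nat.succ_injective (Nat.eq_of_mul_eq_mul_right (by omega) this)
  · have e := (ringGraph n m).overFinIso rfl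
    have h : lambdaMin ((ringGraph n m).overFin rfl) = -1 - Real.sqrt 2 := by
      rw [← lambdaMin_congr e, lambdaMin_ringGraph n (by omega)]
    refine ⟨e.connected_iff.1 (ringGraph_connected n (by omega)), ?_, h.ge, ?_⟩
    · intro v
      rw [← e.symm.degree_eq v]
      exact ringGraph_isRegularOfDegree n m _
    · change lambdaMin ((ringGraph n m).overFin rfl) < -2
      rw [h]
      have : (1 : ℝ) < Real.sqrt 2 := Real.lt_sqrt_of_sq_lt (by norm_num)
      linarith
end

section
/- There exist infinitely many pairwise non-isomorphic connected 3-regular triangle-free finite simple graphs G whose smallest adjacency eigenvalue λmin(G) lies in the half-open interval [−1−√2, −2). -/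
open SimpleGraph Filter

attribute [local instance] Classical.propDecidable

open Matrix in
lemma dotProduct_adjMatrix_mulVec {V : Type} [Fintype V] (G : SimpleGraph V) (x : V → ℝ) :
    x ⬝ᵥ (G.adjMatrix ℝ *ᵥ x) = ∑ v, x v * ∑ w ∈ G.neighborFinset v, x w := by
  simp only [dotProduct, adjMatrix_mulVec_apply]

open Matrix in
lemma le_lambdaMin_iff {V : Type} [Fintype V] [Nonempty V] (G : SimpleGraph V) (c : ℝ) :
    c ≤ lambdaMin G ↔
      ∀ x : V → ℝ, c * ∑ v, x v ^ 2 ≤ ∑ v, x v * ∑ w ∈ G.neighborFinset v, x w := by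
  have hA := adjMatrix_isHermitian G
  have hbasis (i : V) : G.adjMatrix ℝ *ᵥ ⇑(hA.eigenvectorBasis i) =
      hA.eigenvalues i • ⇑(hA.eigenvectorBasis i) := hA.mulVec_eigenvectorBasis i
  rw [lambdaMin, le_ciInf_iff (Set.finite_range _).bddBelow]
  constructor
  · intro h x
    rw [← dotProduct_adjMatrix_mulVec]
    set y : EuclideanSpace ℝ V := WithLp.toLp 2 x with hy
    set z : EuclideanSpace ℝ V := WithLp.toLp 2 (G.adjMatrix ℝ *ᵥ x) with hz
    have h1 : ∑ v, x v ^ 2 = inner ℝ y y := by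
      rw [real_inner_self_eq_norm_sq, EuclideanSpace.real_norm_sq_eq]
    have h2 : x ⬝ᵥ (G.adjMatrix ℝ *ᵥ x) = inner ℝ y z := by
      simp [hy, hz, PiLp.inner_apply, dotProduct, mul_comm]
    have h3 (i : V) : inner ℝ (hA.eigenvectorBasis i) z =
        hA.eigenvalues i * inner ℝ (hA.eigenvectorBasis i) y := by
      have e (w : V → ℝ) : inner ℝ (hA.eigenvectorBasis i) (WithLp.toLp 2 w) =
          ⇑(hA.eigenvectorBasis i) ⬝ᵥ w := by
        simp [PiLp.inner_apply, dotProduct, mul_comm]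
      rw [hz, hy, e, e, dotProduct_mulVec, ← mulVec_transpose, (G.isSymm_adjMatrix).eq, hbasis,
        smul_dotProduct, smul_eq_mul]
    rw [h1, h2, ← hA.eigenvectorBasis.sum_inner_mul_inner y y,
      ← hA.eigenvectorBasis.sum_inner_mul_inner y z, Finset.mul_sum]
    refine Finset.sum_le_sum fun i _ => ?_
    rw [h3, real_inner_comm]
    nlinarith [h i, mul_self_nonneg (inner ℝ (hA.eigenvectorBasis i) y)]
  · intro h i
    have h1 := h (hA.eigenvectorBasis i)
    have h2 : ∑ v, hA.eigenvectorBasis i v ^ 2 = 1 := by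
      rw [← EuclideanSpace.real_norm_sq_eq, hA.eigenvectorBasis.norm_eq_one, one_pow]
    rw [← dotProduct_adjMatrix_mulVec, hbasis, dotProduct_smul, dotProduct] at h1
    simp only [← pow_two, smul_eq_mul] at h1
    rwa [h2, mul_one, mul_one] at h1

lemma lambdaMin_eq_of_iso {V W : Type} [Fintype V] [Fintype W] [Nonempty V]
    {G : SimpleGraph V} {H : SimpleGraph W} (e : G ≃g H) : lambdaMin G = lambdaMin H := by
  have : Nonempty W := e.nonempty_congr.mp ‹_›
  have key {V W : Type} [Fintype V] [Fintype W] [Nonempty V] [Nonempty W]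
      {G : SimpleGraph V} {H : SimpleGraph W} (e : G ≃g H) : lambdaMin G ≤ lambdaMin H := by
    rw [le_lambdaMin_iff]
    intro x
    have h := (le_lambdaMin_iff G _).mp le_rfl (x ∘ e)
    have h1 : ∑ v, (x ∘ e) v ^ 2 = ∑ w, x w ^ 2 := e.toEquiv.sum_comp fun w => x w ^ 2
    have h2 (v : V) : ∑ w ∈ G.neighborFinset v, (x ∘ e) w =
        ∑ w ∈ H.neighborFinset (e v), x w :=
      Finset.sum_equiv e.toEquiv (fun w => by simpa using e.map_adj_iff.symm) (fun w _ => rfl)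
    have h3 : ∑ v, (x ∘ e) v * ∑ w ∈ G.neighborFinset v, (x ∘ e) w =
        ∑ v, x v * ∑ w ∈ H.neighborFinset v, x w := by
      simp only [h2]
      exact e.toEquiv.sum_comp fun v => x v * ∑ w ∈ H.neighborFinset v, x w
    rwa [h1, h3] at h
  exact le_antisymm (key e) (key e.symm)

/-- A proper 3-edge-colouring of a cubic graph on eight vertices: `cellNeighbor k` maps a vertex to
its neighbour along the edge of colour `k`. -/
def cellNeighbor : Fin 3 → Fin 4 × Bool → Fin 4 × Bool
  | 0, (0, s) => (0, !s)
  | 0, (1, s) => (1, !s)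
  | 0, (2, s) => (3, s)
  | 0, (3, s) => (2, s)
  | 1, (0, s) => (1, s)
  | 1, (1, s) => (0, s)
  | 1, (2, s) => (3, !s)
  | 1, (3, s) => (2, !s)
  | 2, (0, s) => (3, s)
  | 2, (1, s) => (2, s)
  | 2, (2, s) => (1, s)
  | 2, (3, s) => (0, s)

/-- The voltages defining the cyclic cover `necklace` of the graph given by `cellNeighbor`. -/
def cellShift : Fin 3 → Fin 4 × Bool → ℤ
  | 2, (0, _) => -1
  | 2, (3, _) => 1
  | _, _ => 0

/-- The neighbour along the edge of colour `k` in the cyclic cover. -/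
def necklaceNeighbor (n : ℕ) (k : Fin 3) (v : ZMod n × (Fin 4 × Bool)) :
    ZMod n × (Fin 4 × Bool) :=
  (v.1 + cellShift k v.2, cellNeighbor k v.2)

lemma necklaceNeighbor_necklaceNeighbor {n : ℕ} (k : Fin 3) (v : ZMod n × (Fin 4 × Bool)) :
    necklaceNeighbor n k (necklaceNeighbor n k v) = v := by
  have h1 : ∀ k x, cellNeighbor k (cellNeighbor k x) = x := by decide
  have h2 : ∀ k x, cellShift k (cellNeighbor k x) = -cellShift k x := by decide
  simp [necklaceNeighbor, h1, h2]

lemma necklaceNeighbor_injective {n : ℕ} (v : ZMod n × (Fin 4 × Bool)) :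
    Function.Injective fun k => necklaceNeighbor n k v := by
  have h : ∀ x k l, cellNeighbor k x = cellNeighbor l x → k = l := by decide
  exact fun k l hkl => h _ _ _ (congrArg Prod.snd hkl)

/-- The cubic graph on `8 * n` vertices consisting of `n` copies of a cell arranged in a cycle. -/
def necklace (n : ℕ) : SimpleGraph (ZMod n × (Fin 4 × Bool)) where
  Adj v w := ∃ k, necklaceNeighbor n k v = w
  symm := ⟨by
    rintro v _ ⟨k, rfl⟩
    exact ⟨k, necklaceNeighbor_necklaceNeighbor k v⟩⟩
  loopless := ⟨by
    rintro v ⟨k, h⟩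
    have h1 : ∀ k x, cellNeighbor k x ≠ x := by decide
    exact h1 _ _ (congrArg Prod.snd h)⟩

lemma necklace_adj_necklaceNeighbor {n : ℕ} (k : Fin 3) (v : ZMod n × (Fin 4 × Bool)) :
    (necklace n).Adj v (necklaceNeighbor n k v) := ⟨k, rfl⟩

lemma necklace_neighborFinset (n : ℕ) [NeZero n] (v : ZMod n × (Fin 4 × Bool)) :
    (necklace n).neighborFinset v =
      Finset.univ.map ⟨fun k => necklaceNeighbor n k v, necklaceNeighbor_injective v⟩ := by
  ext w
  rw [mem_neighborFinset]
  simp [necklace]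

lemma necklace_isRegularOfDegree (n : ℕ) [NeZero n] : (necklace n).IsRegularOfDegree 3 := by
  intro v
  rw [← card_neighborFinset_eq_degree, necklace_neighborFinset]
  simp

lemma necklace_cliqueFree (n : ℕ) : (necklace n).CliqueFree 3 := by
  intro s hs
  obtain ⟨a, b, c, ⟨k, rfl⟩, ⟨l, hl⟩, ⟨m, rfl⟩, -⟩ := is3Clique_iff.mp hs
  have h : ∀ k l m x, cellNeighbor m (cellNeighbor k x) ≠ cellNeighbor l x := by decide
  exact h k l m a.2 (congrArg Prod.snd hl).symm

lemma necklace_connected (n : ℕ) [NeZero n] : (necklace n).Connected := by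
  have step (k : Fin 3) (i j : ZMod n) (x y : Fin 4 × Bool) (hy : cellNeighbor k x = y)
      (hj : i + cellShift k x = j) : (necklace n).Reachable (i, x) (j, y) := by
    subst hy hj
    exact (necklace_adj_necklaceNeighbor k (i, x)).reachable
  have cell (i : ZMod n) (x : Fin 4 × Bool) : (necklace n).Reachable (i, (0, true)) (i, x) := by
    have hc := step 0 i i (0, true) (0, false) rfl (by simp [cellShift])
    have hd (s) := step 1 i i (0, s) (1, s) rfl (by simp [cellShift])
    have hb (s) := step 2 i i (1, s) (2, s) rfl (by simp [cellShift])
    have ha (s) := step 0 i i (2, s) (3, s) rfl (by simp [cellShift])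
    have h0 (s : Bool) : (necklace n).Reachable (i, (0, true)) (i, (0, s)) := by
      cases s
      exacts [hc, .refl _]
    obtain ⟨p, s⟩ := x
    fin_cases p
    exacts [h0 s, (h0 s).trans (hd s), ((h0 s).trans (hd s)).trans (hb s),
      (((h0 s).trans (hd s)).trans (hb s)).trans (ha s)]
  have base (k : ℕ) : (necklace n).Reachable (0, (0, true)) ((k : ZMod n), (0, true)) := by
    induction k with
    | zero => simp
    | succ k ih =>
      exact (ih.trans (cell _ (3, true))).trans (step 2 _ _ _ _ rfl (by simp [cellShift]))
  have all (v) : (necklace n).Reachable (0, (0, true)) v := by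
    have h := base v.1.val
    rw [ZMod.natCast_zmod_val] at h
    exact h.trans (cell v.1 v.2)
  have : Nonempty (ZMod n × (Fin 4 × Bool)) := ⟨(0, (0, true))⟩
  exact ⟨fun v w => (all v).symm.trans (all w)⟩

lemma sum_necklace (n : ℕ) [NeZero n] (f : ZMod n × (Fin 4 × Bool) → ℝ) :
    ∑ v, f v = ∑ i, ((f (i, 0, true) + f (i, 0, false)) + (f (i, 1, true) + f (i, 1, false)) +
      (f (i, 2, true) + f (i, 2, false)) + (f (i, 3, true) + f (i, 3, false))) := by
  simp only [Fintype.sum_prod_type, Fin.sum_univ_four, Fintype.sum_bool]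

lemma sum_necklace_neighborFinset (n : ℕ) [NeZero n] (x : ZMod n × (Fin 4 × Bool) → ℝ)
    (v : ZMod n × (Fin 4 × Bool)) : ∑ w ∈ (necklace n).neighborFinset v, x w =
      x (necklaceNeighbor n 0 v) + x (necklaceNeighbor n 1 v) + x (necklaceNeighbor n 2 v) := by
  rw [necklace_neighborFinset, Finset.sum_map]
  simp [Fin.sum_univ_three]

lemma le_lambdaMin_necklace (n : ℕ) [NeZero n] : -1 - √2 ≤ lambdaMin (necklace n) := by
  rw [le_lambdaMin_iff]
  intro x
  rw [← sub_nonneg]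
  simp only [sum_necklace_neighborFinset]
  rw [sum_necklace, sum_necklace, Finset.mul_sum, ← Finset.sum_sub_distrib]
  simp only [necklaceNeighbor, cellNeighbor, cellShift, Int.cast_zero, Int.cast_one, Int.cast_neg,
    add_zero, Bool.not_true, Bool.not_false]
  set σ := √2
  have hσ : σ ^ 2 = 2 := Real.sq_sqrt (by norm_num)
  have hσ1 : 1 ≤ σ := Real.one_le_sqrt.mpr (by norm_num)
  let u (i : ZMod n) : ℝ :=
    x (i, 3, true) * x (i + 1, 0, true) + x (i, 3, false) * x (i + 1, 0, false) +
      ((σ - 1) * (x (i + 1, 0, true) - x (i + 1, 0, false)) ^ 2 +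
        (σ + 1) * (x (i + 1, 0, true) + x (i + 1, 0, false)) ^ 2) / 2
  have hu : ∑ i, (u (i + -1) - u i) = 0 := by
    rw [Finset.sum_sub_distrib, sub_eq_zero]
    exact Fintype.sum_equiv (Equiv.addRight (-1 : ZMod n)) _ _ fun _ => rfl
  rw [← hu]
  refine Finset.sum_le_sum fun i _ => ?_
  simp only [u, neg_add_cancel_right]
  generalize x (i, 0, true) = c₁, x (i, 0, false) = c₂, x (i, 1, true) = d₁,
    x (i, 1, false) = d₂, x (i, 2, true) = b₁, x (i, 2, false) = b₂, x (i, 3, true) = a₁,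
    x (i, 3, false) = a₂, x (i + 1, 0, true) = c₁', x (i + 1, 0, false) = c₂',
    x (i + -1, 3, true) = a₁', x (i + -1, 3, false) = a₂'
  have h : 0 ≤ (σ + 1) * ((a₁ - a₂) + (σ - 1) * (c₁' - c₂')) ^ 2 +
      (σ - 1) * ((a₁ + a₂) + (σ + 1) * (c₁' + c₂')) ^ 2 +
      (σ + 1) * ((b₁ - b₂) + (σ - 1) * (d₁ - d₂)) ^ 2 +
      (σ - 1) * ((b₁ + b₂) + (σ + 1) * (d₁ + d₂)) ^ 2 +
      ((c₁ - c₂) + (d₁ - d₂)) ^ 2 + ((c₁ + c₂) + (d₁ + d₂)) ^ 2 +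
      2 * ((a₁ + a₂) + (b₁ + b₂)) ^ 2 := by
    have := sub_nonneg.mpr hσ1
    positivity
  rw [← sub_nonneg]
  refine (div_nonneg h zero_le_two).trans_eq ?_
  linear_combination ((a₁ - a₂) * (c₁' - c₂') + (a₁ + a₂) * (c₁' + c₂') +
    (b₁ - b₂) * (d₁ - d₂) + (b₁ + b₂) * (d₁ + d₂) +
    ((σ - 1) * (c₁' - c₂') ^ 2 + (σ + 1) * (c₁' + c₂') ^ 2 +
      (σ - 1) * (d₁ - d₂) ^ 2 + (σ + 1) * (d₁ + d₂) ^ 2) / 2) * hσ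

lemma lambdaMin_necklace_lt (n : ℕ) [NeZero n] : lambdaMin (necklace n) < -2 := by
  rw [← not_le, le_lambdaMin_iff]
  intro h
  let y : Fin 4 × Bool → ℝ
    | (0, s) => if s then -2 else 2
    | (1, s) => if s then 2 else -2
    | (2, s) => if s then -1 else 1
    | (3, s) => if s then 1 else -1
  have h1 := h fun v => y v.2
  simp only [sum_necklace_neighborFinset] at h1
  rw [sum_necklace, sum_necklace] at h1
  simp only [necklaceNeighbor, cellNeighbor, y, Finset.sum_const, nsmul_eq_mul] at h1
  have hn : (0 : ℝ) < n := Nat.cast_pos.mpr (NeZero.pos n)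
  norm_num at h1
  linarith

/-- There exist infinitely many pairwise non-isomorphic connected 3-regular triangle-free
finite simple graphs whose smallest adjacency eigenvalue lies in `[-1-√2, -2)`. -/
theorem stmt_1 :
    ∃ f : ℕ → Σ n : ℕ, SimpleGraph (Fin n),
      (∀ i j : ℕ, i ≠ j → ¬ Nonempty ((f i).2 ≃g (f j).2)) ∧
      (∀ i : ℕ, ((f i).2.Connected ∧ (f i).2.IsRegularOfDegree 3 ∧ (f i).2.CliqueFree 3 ∧
        -1 - Real.sqrt 2 ≤ lambdaMin (f i).2 ∧ lambdaMin (f i).2 < -2)) := by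
  let e (i : ℕ) := (necklace (i + 1)).overFinIso rfl
  refine ⟨fun i => ⟨_, (necklace (i + 1)).overFin rfl⟩, ?_, fun i => ⟨?_, ?_, ?_, ?_, ?_⟩⟩
  · rintro i j hij ⟨g⟩
    have h := g.card_eq
    simp only [Fintype.card_fin, Fintype.card_prod, ZMod.card, Fintype.card_bool] at h
    omega
  · exact (e i).connected_iff.mp (necklace_connected _)
  · intro v
    rw [← (e i).symm.degree_eq]
    exact necklace_isRegularOfDegree _ _
  · exact (necklace_cliqueFree _).comap ⟨(e i).symm.toCopy⟩
  · rw [← lambdaMin_eq_of_iso (e i)]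
    exact le_lambdaMin_necklace _
  · rw [← lambdaMin_eq_of_iso (e i)]
    exact lambdaMin_necklace_lt _
end
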